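/- Let N > 1 be an integer, ξ ∈ ℂˣ with ξ^N = 1, and n a positive integer dividing 2N². If n is odd, or if b₂(N) = b₂(ord(ξ)) = b₂(n) − 1 ≥ 1, then n divides gcd(N,n)² in ℤ; otherwise (so in particular n is even) n divides gcd(N,n)² + N·gcd(N, n/2) in ℤ. (This is the Frobenius divisibility property for the n-th Frobenius–Schur indicator of the regular representation of the Hopf algebra H_{2N²}(ξ), whose value is computed in the paper's Theorem 5.1.) -/

import Mathlib

theorem Nat.gcd_two_mul_right_of_odd {a c : ℕ} (ha : Odd a) : Nat.gcd a (2 * c) = Nat.gcd a c :=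
  Nat.Coprime.gcd_mul_left_cancel_right c (Nat.coprime_two_left.mpr ha)

/-- A decomposition of `N` and `m` along their greatest common divisor when `m ∣ N ^ 2`. -/
theorem Nat.exists_eq_mul_of_dvd_sq {N m : ℕ} (hm : 0 < m) (h : m ∣ N ^ 2) :
    ∃ d a c e : ℕ, 0 < d ∧ Nat.Coprime a c ∧ N = d * a ∧ m = d * c ∧ d = c * e := by
  obtain ⟨a, c, hac, hN, hmc⟩ := Nat.exists_coprime N m
  have hd : 0 < Nat.gcd N m := Nat.gcd_pos_of_pos_right N hm
  generalize Nat.gcd N m = d at hN hmc hd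
  have hc : d * c ∣ d * (d * a ^ 2) := by
    have : d * (d * a ^ 2) = N ^ 2 := by rw [hN]; ring
    rw [this, mul_comm d c, ← hmc]
    exact h
  obtain ⟨e, he⟩ := (Nat.Coprime.pow_right 2 hac.symm).dvd_of_dvd_mul_right
    (Nat.dvd_of_mul_dvd_mul_left hd hc)
  exact ⟨d, a, c, e, hd, hac, by rw [hN, mul_comm], by rw [hmc, mul_comm], he⟩

theorem Nat.two_mul_dvd_gcd_sq_add {N m : ℕ} (hm : 0 < m) (h : m ∣ N ^ 2) :
    2 * m ∣ Nat.gcd N (2 * m) ^ 2 + N * Nat.gcd N m := by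
  obtain ⟨d, a, c, e, -, hac, rfl, rfl, he⟩ := Nat.exists_eq_mul_of_dvd_sq hm h
  rw [mul_left_comm 2 d c, Nat.gcd_mul_left, Nat.gcd_mul_left, hac.gcd_eq_one]
  rcases Nat.even_or_odd a with ha | ha
  · obtain ⟨k, hk⟩ := even_iff_two_dvd.mp ha
    obtain ⟨g, hg⟩ := Nat.dvd_gcd (even_iff_two_dvd.mp ha) (Nat.dvd_mul_right 2 c)
    rw [hg, hk]
    exact ⟨2 * e * g ^ 2 + e * k, by rw [he]; ring⟩
  · rw [Nat.gcd_two_mul_right_of_odd ha, hac.gcd_eq_one]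
    obtain ⟨k, hk⟩ := ha
    exact ⟨e * (k + 1), by rw [hk, he]; ring⟩

theorem Nat.dvd_gcd_sq {N n : ℕ} (h : n ∣ N ^ 2) : n ∣ Nat.gcd N n ^ 2 := by
  rw [← Nat.pow_gcd_pow]
  exact Nat.dvd_gcd h (dvd_pow_self n two_ne_zero)

theorem Nat.two_mul_dvd_sq_of_padicValNat_eq {N m : ℕ} (hm : 0 < m) (h : m ∣ N ^ 2)
    (hN : 1 ≤ padicValNat 2 N) (hv : padicValNat 2 N = padicValNat 2 m) : 2 * m ∣ N ^ 2 := by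
  obtain ⟨d, a, c, e, hd, hac, rfl, rfl, he⟩ := Nat.exists_eq_mul_of_dvd_sq hm h
  have hc : c ≠ 0 := by rintro rfl; simp at hm
  have ha : a ≠ 0 := by rintro rfl; simp at hN
  have key : 2 ∣ e * a ^ 2 := by
    rcases Nat.even_or_odd a with h2 | h2
    · exact ((even_iff_two_dvd.mp h2).pow two_ne_zero).mul_left e
    · have hc2 : ¬ 2 ∣ c := by
        rw [padicValNat.mul hd.ne' ha, padicValNat.mul hd.ne' hc,
          padicValNat.eq_zero_of_not_dvd h2.not_two_dvd_nat] at hv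
        intro h'
        have := one_le_padicValNat_of_dvd hc h'
        omega
      have h2N : 2 ∣ d * a := dvd_of_one_le_padicValNat hN
      rw [he, mul_assoc] at h2N
      exact ((Nat.prime_two.dvd_mul.mp h2N).resolve_left hc2).trans ⟨a, by ring⟩
  obtain ⟨k, hk⟩ := key
  refine ⟨k, ?_⟩
  calc (d * a) ^ 2 = d * c * (e * a ^ 2) := by rw [he]; ring
    _ = 2 * (d * c) * k := by rw [hk]; ring


theorem stmt_19 (N : ℕ) (hN : 1 < N) (ξ : ℂˣ) (hξ : ξ ^ N = 1)
    (n : ℕ) (hn : 0 < n) (hdvd : n ∣ 2 * N ^ 2) :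
    ((Odd n ∨ (padicValNat 2 N = padicValNat 2 n - 1 ∧
        padicValNat 2 (orderOf ξ) = padicValNat 2 n - 1 ∧
        1 ≤ padicValNat 2 n - 1)) →
      n ∣ Nat.gcd N n ^ 2) ∧
    (¬ (Odd n ∨ (padicValNat 2 N = padicValNat 2 n - 1 ∧
        padicValNat 2 (orderOf ξ) = padicValNat 2 n - 1 ∧
        1 ≤ padicValNat 2 n - 1)) →
      n ∣ Nat.gcd N n ^ 2 + N * Nat.gcd N (n / 2)) := by
  have half_dvd {m : ℕ} (h : 2 * m ∣ 2 * N ^ 2) : m ∣ N ^ 2 :=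
    Nat.dvd_of_mul_dvd_mul_left two_pos h
  constructor
  · intro h
    apply Nat.dvd_gcd_sq
    rcases h with h | ⟨h1, -, h3⟩
    · exact (Nat.coprime_two_right.mpr h).dvd_of_dvd_mul_left hdvd
    · obtain ⟨m, rfl⟩ : 2 ∣ n := dvd_of_one_le_padicValNat (by omega)
      have hm : 0 < m := by omega
      rw [padicValNat.mul two_ne_zero hm.ne', padicValNat_self] at h1 h3
      exact Nat.two_mul_dvd_sq_of_padicValNat_eq hm (half_dvd hdvd) (by omega) (by omega)
  · intro h
    obtain ⟨m, rfl⟩ := even_iff_two_dvd.mp (Nat.not_odd_iff_even.mp fun ho => h (Or.inl ho))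
    rw [Nat.mul_div_cancel_left m two_pos]
    exact Nat.two_mul_dvd_gcd_sq_add (by omega) (half_dvd hdvd)
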